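/- Fix t > 0, κ > 0, r > 0, η ≥ 8qr/t and R > max(2ηt/q, 3κ). There exists T₀ > e such that for every T ≥ T₀ the following holds: if a potential ξ_T : L_T → (0,∞) satisfies (A) there exists x ∈ L_T(0,r) with η ≤ ξ_T(x) < 2η, (B) ξ_T(y) ≤ η/2 for every y ∈ L_T(0,R) \ {x}, (C) h_T(z) ≤ t/8 for every z ∈ L_T(0,r), and (S1) ξ_T(y) < η + q(|y| − r)/t for every y ∈ L_T with y ∉ B(0,R), then x is the unique maximizer on L_T of z ↦ λ_T(z,t) and also the unique maximizer on L_T of z ↦ m_T(z,t). -/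

import Mathlib

open MeasureTheory ProbabilityTheory Real

noncomputable section

/-- The ℓ¹-norm on `ℝ^d`. -/
def l1 {d : ℕ} (z : Fin d → ℝ) : ℝ := ∑ i, |z i|

/-- Membership in the rescaled lattice `L_T = {z ∈ ℝ^d : r(T) z ∈ ℤ^d}`. -/
def inLatt {d : ℕ} (rT : ℝ) (z : Fin d → ℝ) : Prop := ∀ i, ∃ m : ℤ, rT * z i = (m : ℝ)

/-- The rescaled potential `ξ_T(z) = ξ(r(T) z) / a(T)` built from the environment `ξ` on `ℤ^d`. -/
def envPot {Ω : Type*} {d : ℕ} (aT rT : ℝ) (ξ : (Fin d → ℤ) → Ω → ℝ) (ω : Ω)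
    (z : Fin d → ℝ) : ℝ :=
  ξ (fun i => ⌊rT * z i⌋) ω / aT

/-- The cost `∑_{j=1}^n q|y_{j-1} - y_j| / ξ_T(y_j)` of the path `y 0, …, y n`. -/
def pathCost {d : ℕ} (q : ℝ) (ξT : (Fin d → ℝ) → ℝ) (n : ℕ) (y : ℕ → Fin d → ℝ) : ℝ :=
  ∑ j ∈ Finset.range n, q * l1 (y j - y (j + 1)) / ξT (y (j + 1))

/-- The lilypad hitting time `h_T(z)`. -/
def hitTime {d : ℕ} (q rT : ℝ) (ξT : (Fin d → ℝ) → ℝ) (z : Fin d → ℝ) : ℝ :=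
  sInf {s : ℝ | ∃ n : ℕ, 1 ≤ n ∧ ∃ y : ℕ → Fin d → ℝ,
    (∀ j ≤ n, inLatt rT (y j)) ∧ y 0 = z ∧ y n = 0 ∧ s = pathCost q ξT n y}

/-- The rounding `[x]_T` of `x ∈ ℝ^d` to the lattice `L_T`. -/
def roundT {d : ℕ} (rT : ℝ) (x : Fin d → ℝ) : Fin d → ℝ := fun i => (⌊rT * x i⌋ : ℝ) / rT

/-- The PAM lilypad hitting time `τ_T(z) = inf_y q(|y| + |z-y|)/ξ_T(y)`. -/
def tauT {d : ℕ} (q rT : ℝ) (ξT : (Fin d → ℝ) → ℝ) (z : Fin d → ℝ) : ℝ :=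
  sInf {s : ℝ | ∃ y : Fin d → ℝ, inLatt rT y ∧ s = q * (l1 y + l1 (z - y)) / ξT y}

/-- The BRW lilypad profile `m_T(z,t) = sup_y { ξ_T(y)(t - h_T(y))_+ - q|z-y| }`. -/
def mT {d : ℕ} (q rT : ℝ) (ξT : (Fin d → ℝ) → ℝ) (z : Fin d → ℝ) (t : ℝ) : ℝ :=
  sSup {v : ℝ | ∃ y : Fin d → ℝ, inLatt rT y ∧
    v = ξT y * max (t - hitTime q rT ξT y) 0 - q * l1 (z - y)}

/-- The PAM lilypad profile `λ_T(z,t) = sup_y { ξ_T(y) t - q|y| - q|z-y| } ∨ 0`. -/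
def lamT {d : ℕ} (q rT : ℝ) (ξT : (Fin d → ℝ) → ℝ) (z : Fin d → ℝ) (t : ℝ) : ℝ :=
  max (sSup {v : ℝ | ∃ y : Fin d → ℝ, inLatt rT y ∧
    v = ξT y * t - q * l1 y - q * l1 (z - y)}) 0

/-- `a(T) = (T / log T)^q`. -/
def aOf (q T : ℝ) : ℝ := (T / Real.log T) ^ q

/-- `r(T) = (T / log T)^(q+1)`. -/
def rOf (q T : ℝ) : ℝ := (T / Real.log T) ^ (q + 1)

end

lemma l1_nonneg {d : ℕ} (z : Fin d → ℝ) : 0 ≤ l1 z :=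
  Finset.sum_nonneg fun _ _ => abs_nonneg _

lemma l1_zero {d : ℕ} : l1 (0 : Fin d → ℝ) = 0 := by simp [l1]

lemma l1_pos {d : ℕ} {z : Fin d → ℝ} (hz : z ≠ 0) : 0 < l1 z := by
  obtain ⟨i, hi⟩ := Function.ne_iff.mp hz
  exact Finset.sum_pos' (fun _ _ => abs_nonneg _) ⟨i, Finset.mem_univ i, abs_pos.mpr hi⟩

lemma l1_le_add_sub {d : ℕ} (y z : Fin d → ℝ) : l1 y ≤ l1 z + l1 (y - z) := by
  simp only [l1, ← Finset.sum_add_distrib]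
  refine Finset.sum_le_sum fun i _ => ?_
  simpa using abs_add_le (z i) (y i - z i)

lemma inLatt_zero {d : ℕ} (rT : ℝ) : inLatt rT (0 : Fin d → ℝ) := fun _ => ⟨0, by simp⟩

/-- Each step of a lattice path has nonnegative cost. -/
lemma step_cost_nonneg {d : ℕ} {q rT : ℝ} {ξT : (Fin d → ℝ) → ℝ} (hq : 0 ≤ q)
    (hξ : ∀ z, inLatt rT z → 0 < ξT z) (y : Fin d → ℝ) {z : Fin d → ℝ} (hz : inLatt rT z) :
    0 ≤ q * l1 (y - z) / ξT z :=
  div_nonneg (mul_nonneg hq (l1_nonneg _)) (hξ z hz).le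

lemma hitTime_nonneg {d : ℕ} {q rT : ℝ} {ξT : (Fin d → ℝ) → ℝ} (hq : 0 ≤ q)
    (hξ : ∀ z, inLatt rT z → 0 < ξT z) (z : Fin d → ℝ) : 0 ≤ hitTime q rT ξT z := by
  refine Real.sInf_nonneg ?_
  rintro _ ⟨n, -, y, hy, -, -, rfl⟩
  refine Finset.sum_nonneg fun j hj => step_cost_nonneg hq hξ _ (hy _ ?_)
  exact Finset.mem_range.mp hj

lemma pathCost_succ' {d : ℕ} (q : ℝ) (ξT : (Fin d → ℝ) → ℝ) (n : ℕ) (y : ℕ → Fin d → ℝ) :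
    pathCost q ξT (n + 1) y =
      pathCost q ξT n (fun j => y (j + 1)) + q * l1 (y 0 - y 1) / ξT (y 1) :=
  Finset.sum_range_succ' _ _

/-- If the potential is at most `M` in the ball of radius `R`, then any lattice path to the origin
costs at least the time needed to cross that ball at speed `M / q`. -/
lemma min_le_pathCost {d : ℕ} {q rT M R : ℝ} {ξT : (Fin d → ℝ) → ℝ} (hq : 0 ≤ q) (hM : 0 < M)
    (hξ : ∀ z, inLatt rT z → 0 < ξT z) (hbd : ∀ z, inLatt rT z → l1 z < R → ξT z ≤ M)
    (n : ℕ) (y : ℕ → Fin d → ℝ) (hy : ∀ j ≤ n, inLatt rT (y j)) (hn : y n = 0) :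
    q * min (l1 (y 0)) R / M ≤ pathCost q ξT n y := by
  induction n generalizing y with
  | zero =>
    have : min (l1 (y 0)) R ≤ 0 := by simp [hn, l1_zero]
    simpa [pathCost] using
      div_nonpos_of_nonpos_of_nonneg (mul_nonpos_of_nonneg_of_nonpos hq this) hM.le
  | succ n ih =>
    have h := ih (fun j => y (j + 1)) (fun j hj => hy _ (by lia)) hn
    rw [pathCost_succ']
    have h1 : inLatt rT (y 1) := hy 1 (by lia)
    simp only [zero_add] at h
    by_cases hR : l1 (y 1) < R
    · have hstep : q * l1 (y 0 - y 1) / M ≤ q * l1 (y 0 - y 1) / ξT (y 1) :=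
        div_le_div_of_nonneg_left (mul_nonneg hq (l1_nonneg _)) (hξ _ h1) (hbd _ h1 hR)
      have htri : q * min (l1 (y 0)) R / M ≤
          q * min (l1 (y 1)) R / M + q * l1 (y 0 - y 1) / M := by
        rw [← add_div, ← mul_add, min_eq_left hR.le]
        gcongr
        exact (min_le_left _ _).trans (l1_le_add_sub _ _)
      linarith
    · have hmin : q * min (l1 (y 0)) R / M ≤ q * min (l1 (y 1)) R / M := by
        rw [min_eq_right (not_lt.mp hR)]
        gcongr
        exact min_le_right _ _
      have := step_cost_nonneg hq hξ (y 0) h1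
      linarith

lemma min_le_hitTime {d : ℕ} {q rT M R : ℝ} {ξT : (Fin d → ℝ) → ℝ} (hq : 0 ≤ q) (hM : 0 < M)
    (hξ : ∀ z, inLatt rT z → 0 < ξT z) (hbd : ∀ z, inLatt rT z → l1 z < R → ξT z ≤ M)
    {z : Fin d → ℝ} (hz : inLatt rT z) :
    q * min (l1 z) R / M ≤ hitTime q rT ξT z := by
  refine le_csInf ⟨_, 1, le_rfl, fun j => if j = 0 then z else 0, ?_, by simp, by simp, rfl⟩ ?_
  · intro j _
    dsimp only
    split_ifs
    exacts [hz, inLatt_zero rT]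
  · rintro _ ⟨n, -, y, hy, rfl, hn, rfl⟩
    exact min_le_pathCost hq hM hξ hbd n y hy hn

/-- A profile built from cones of slope `q` has, at the site of the strictly dominating cone,
a value at least the height of that cone and strictly above its value at any other site. -/
lemma sSup_cone_lt {d : ℕ} {q rT δ : ℝ} (hq : 0 < q) (hδ : 0 < δ) (f : (Fin d → ℝ) → ℝ)
    {x : Fin d → ℝ} (hx : inLatt rT x) (hf : ∀ y, inLatt rT y → y ≠ x → f y + δ ≤ f x) :
    f x ≤ sSup {v : ℝ | ∃ y : Fin d → ℝ, inLatt rT y ∧ v = f y - q * l1 (x - y)} ∧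
      ∀ z, z ≠ x →
        sSup {v : ℝ | ∃ y : Fin d → ℝ, inLatt rT y ∧ v = f y - q * l1 (z - y)} < f x := by
  constructor
  · refine le_csSup ⟨f x, ?_⟩ ⟨x, hx, by simp [l1_zero]⟩
    rintro _ ⟨y, hy, rfl⟩
    have := mul_nonneg hq.le (l1_nonneg (x - y))
    by_cases hyx : y = x
    · subst hyx; linarith
    · linarith [hf y hy hyx]
  · intro z hz
    have hpos : 0 < q * l1 (z - x) := mul_pos hq (l1_pos (sub_ne_zero.mpr hz))
    refine lt_of_le_of_lt (b := f x - min δ (q * l1 (z - x))) (csSup_le ⟨_, x, hx, rfl⟩ ?_) ?_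
    · rintro _ ⟨y, hy, rfl⟩
      by_cases hyx : y = x
      · subst hyx; linarith [min_le_right δ (q * l1 (z - y))]
      · linarith [hf y hy hyx, min_le_left δ (q * l1 (z - x)),
          mul_nonneg hq.le (l1_nonneg (z - y))]
    · linarith [lt_min hδ hpos]

/-- **Lemma 8.2(i).** Under (A), (B), (C) and (S1), for large `T`, the point `x` is the
unique maximizer of both the PAM lilypad profile `λ_T(·,t)` and the BRW lilypad profile
`m_T(·,t)`. -/
theorem same_maximizer_scenario
    (d : ℕ) (hd : 1 ≤ d) (α : ℝ) (hα : (d : ℝ) < α)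
    (q : ℝ) (hq : q = d / (α - d))
    (t κ r η R : ℝ) (ht : 0 < t) (hκ : 0 < κ) (hr : 0 < r)
    (hη : 8 * q * r / t ≤ η) (hR : max (2 * η * t / q) (3 * κ) < R) :
    ∃ T₀ : ℝ, Real.exp 1 < T₀ ∧ ∀ T : ℝ, T₀ ≤ T →
      ∀ ξT : (Fin d → ℝ) → ℝ, (∀ z, inLatt (rOf q T) z → 0 < ξT z) →
      ∀ x : Fin d → ℝ, inLatt (rOf q T) x → l1 x < r → η ≤ ξT x → ξT x < 2 * η →
      (∀ y, inLatt (rOf q T) y → l1 y < R → y ≠ x → ξT y ≤ η / 2) →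
      (∀ z, inLatt (rOf q T) z → l1 z < r → hitTime q (rOf q T) ξT z ≤ t / 8) →
      (∀ y, inLatt (rOf q T) y → ¬ l1 y < R → ξT y < η + q * (l1 y - r) / t) →
      (∀ z, inLatt (rOf q T) z → z ≠ x →
          lamT q (rOf q T) ξT z t < lamT q (rOf q T) ξT x t)
      ∧ (∀ z, inLatt (rOf q T) z → z ≠ x →
          mT q (rOf q T) ξT z t < mT q (rOf q T) ξT x t) := by
  have hq0 : 0 < q := by
    rw [hq]
    exact div_pos (by exact_mod_cast hd) (sub_pos.mpr hα)
  have hηt : 8 * q * r ≤ η * t := (div_le_iff₀ ht).mp hη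
  have hqr : 0 < q * r := mul_pos hq0 hr
  have hη0 : 0 < η := lt_of_lt_of_le (by positivity) hη
  have hRη : 2 * η * t < R * q := (div_lt_iff₀ hq0).mp ((le_max_left _ _).trans_lt hR)
  refine ⟨Real.exp 1 + 1, by linarith, fun T _ ξT hξ x hx hxr hηx hx2 hB hC hS => ?_⟩
  have hxt : η * t ≤ ξT x * t := by gcongr
  have hxq : q * l1 x < q * r := by gcongr
  have hgap : 0 < min (η * t / 4) (q * (r - l1 x)) :=
    lt_min (by positivity) (mul_pos hq0 (sub_pos.mpr hxr))
  constructor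
  · obtain ⟨hge, hlt⟩ := sSup_cone_lt hq0 hgap (fun y => ξT y * t - q * l1 y) hx (by
      intro y hy hyx
      by_cases hyR : l1 y < R
      · have hyt : ξT y * t ≤ η / 2 * t := by gcongr; exact hB y hy hyR hyx
        linarith [min_le_left (η * t / 4) (q * (r - l1 x)), mul_nonneg hq0.le (l1_nonneg y)]
      · have hyt : ξT y * t ≤ (η + q * (l1 y - r) / t) * t := by gcongr; exact (hS y hy hyR).le
        rw [add_mul, div_mul_cancel₀ _ ht.ne'] at hyt
        linarith [min_le_right (η * t / 4) (q * (r - l1 x))])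
    exact fun z _ hzx =>
      (max_lt (hlt z hzx) (by linarith)).trans_le (hge.trans (le_max_left _ _))
  · have hbd : ∀ z, inLatt (rOf q T) z → l1 z < R → ξT z ≤ 2 * η := by
      intro z hz hzR
      by_cases hzx : z = x
      · exact hzx ▸ hx2.le
      · linarith [hB z hz hzR hzx]
    obtain ⟨hge, hlt⟩ := sSup_cone_lt hq0 (by positivity : 0 < η * t / 4)
      (fun y => ξT y * max (t - hitTime q (rOf q T) ξT y) 0) hx (by
        intro y hy hyx
        have hxmax : η * (7 / 8 * t) ≤ ξT x * max (t - hitTime q (rOf q T) ξT x) 0 := by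
          have : 7 / 8 * t ≤ t - hitTime q (rOf q T) ξT x := by linarith [hC x hx hxr]
          exact mul_le_mul hηx (le_max_of_le_left this) (by positivity) (hξ x hx).le
        have hymax : ξT y * max (t - hitTime q (rOf q T) ξT y) 0 ≤ η / 2 * t := by
          by_cases hyR : l1 y < R
          · have := hitTime_nonneg hq0.le hξ y
            have := hB y hy hyR hyx
            gcongr
            exact max_le (by linarith) ht.le
          · have hcross := min_le_hitTime hq0.le (by positivity : 0 < 2 * η) hξ hbd hy
            rw [min_eq_right (not_lt.mp hyR)] at hcross
            have htR : t < q * R / (2 * η) := by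
              rw [lt_div_iff₀ (by positivity)]
              linarith
            rw [max_eq_right (by linarith), mul_zero]
            positivity
        linarith [mul_pos hη0 ht])
    exact fun z _ hzx => (hlt z hzx).trans_le hge
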